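/- There is a computable function h such that for all m, e ∈ ℕ, h(m,e) codes a u.c.e. family F_{m,e} satisfying: (1) if W_e is coinfinite, then F_{m,e} is TxtBC-learnable by some learner but is not TxtBC-learned by the m-th learner M_m; and (2) there is a single computable learner N that TxtBC-learns F_{m,e} simultaneously for every m and every e with W_e cofinite. -/

import Mathlib

/-- `Wset e` is the `e`-th computably enumerable set: the domain of the `e`-th
partial computable function in the standard numbering by codes. -/
def Wset (e : ℕ) : Set ℕ :=
  {x | ((Denumerable.ofNat Nat.Partrec.Code e).eval x).Dom}

/-- The `i`-th column `{x : ⟨i,x⟩ ∈ W_a}` of the c.e. set coded by `a`;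
the number `a` codes the u.c.e. family whose members are its columns. -/
def column (a i : ℕ) : Set ℕ := {x | Nat.pair i x ∈ Wset a}

/-- The initial segment of length `n` of an enumeration `f`. -/
def initSeg (f : ℕ → ℕ) (n : ℕ) : List ℕ := (List.range n).map f

/-- The `m`-th computable learner in the standard effective enumeration of all
partial computable functions from finite sequences to ℕ. -/
def learnerOfCode (m : ℕ) : List ℕ →. ℕ :=
  fun σ => (Denumerable.ofNat Nat.Partrec.Code m).eval (Encodable.encode σ)

/-- `M` TxtFin-identifies the enumeration `f` (here `Option.none` plays the
role of the symbol `?`). -/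
def TxtFinIdentifies (M : List ℕ →. Option ℕ) (f : ℕ → ℕ) : Prop :=
  ∃ n h, (∀ n' < n, M (initSeg f n') = Part.some Option.none) ∧
    M (initSeg f n) = Part.some (Option.some h) ∧ Wset h = Set.range f

/-- `M` TxtFin-learns the set `S`. -/
def TxtFinLearnsSet (M : List ℕ →. Option ℕ) (S : Set ℕ) : Prop :=
  ∀ f : ℕ → ℕ, Set.range f = S → TxtFinIdentifies M f

/-- `M` TxtEx-identifies the enumeration `f`. -/
def TxtExIdentifies (M : List ℕ →. ℕ) (f : ℕ → ℕ) : Prop :=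
  ∃ n, (∃ N, ∀ i ≥ N, M (initSeg f i) = Part.some n) ∧ Wset n = Set.range f

/-- `M` TxtEx-learns the set `S`. -/
def TxtExLearnsSet (M : List ℕ →. ℕ) (S : Set ℕ) : Prop :=
  ∀ f : ℕ → ℕ, Set.range f = S → TxtExIdentifies M f

/-- `M` TxtBC-identifies the enumeration `f`. -/
def TxtBCIdentifies (M : List ℕ →. ℕ) (f : ℕ → ℕ) : Prop :=
  ∃ N, ∀ i ≥ N, ∃ h, M (initSeg f i) = Part.some h ∧ Wset h = Set.range f

/-- `M` TxtBC-learns the set `S`. -/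
def TxtBCLearnsSet (M : List ℕ →. ℕ) (S : Set ℕ) : Prop :=
  ∀ f : ℕ → ℕ, Set.range f = S → TxtBCIdentifies M f

/-- `M` TxtEx*-identifies the enumeration `f`. -/
def TxtExStarIdentifies (M : List ℕ →. ℕ) (f : ℕ → ℕ) : Prop :=
  ∃ n, (∃ N, ∀ i ≥ N, M (initSeg f i) = Part.some n) ∧
    (symmDiff (Wset n) (Set.range f)).Finite

/-- `M` TxtEx*-learns the set `S`. -/
def TxtExStarLearnsSet (M : List ℕ →. ℕ) (S : Set ℕ) : Prop :=
  ∀ f : ℕ → ℕ, Set.range f = S → TxtExStarIdentifies M f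

/-- Indices of cofinite c.e. sets. -/
def COF : Set ℕ := {e | (Wset e)ᶜ.Finite}

/-- Indices of coinfinite c.e. sets. -/
def COINF : Set ℕ := {e | (Wset e)ᶜ.Infinite}

/-- `P` is Σ⁰₃: definable by `∃∀∃` over a computable relation. -/
def IsSigma3 (P : Set ℕ) : Prop :=
  ∃ R : ℕ → ℕ → ℕ → ℕ → Bool,
    Computable (fun p : ℕ × ℕ × ℕ × ℕ => R p.1 p.2.1 p.2.2.1 p.2.2.2) ∧
    ∀ e, e ∈ P ↔ ∃ x, ∀ y, ∃ z, R e x y z = true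

/-- `P` is Σ⁰₄: definable by `∃∀∃∀` over a computable relation. -/
def IsSigma4 (P : Set ℕ) : Prop :=
  ∃ R : ℕ → ℕ → ℕ → ℕ → ℕ → Bool,
    Computable (fun p : ℕ × ℕ × ℕ × ℕ × ℕ =>
      R p.1 p.2.1 p.2.2.1 p.2.2.2.1 p.2.2.2.2) ∧
    ∀ e, e ∈ P ↔ ∃ x, ∀ y, ∃ z, ∀ w, R e x y z w = true

/-- `P` is Σ⁰₅: definable by `∃∀∃∀∃` over a computable relation. -/
def IsSigma5 (P : Set ℕ) : Prop :=
  ∃ R : ℕ → ℕ → ℕ → ℕ → ℕ → ℕ → Bool,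
    Computable (fun p : ℕ × ℕ × ℕ × ℕ × ℕ × ℕ =>
      R p.1 p.2.1 p.2.2.1 p.2.2.2.1 p.2.2.2.2.1 p.2.2.2.2.2) ∧
    ∀ e, e ∈ P ↔ ∃ x, ∀ y, ∃ z, ∀ w, ∃ v, R e x y z w v = true

/-- `f : ℕ → ℕ` is Δ⁰₂: the pointwise limit of a computable function. -/
def IsDelta2Fun (f : ℕ → ℕ) : Prop :=
  ∃ g : ℕ → ℕ → ℕ, Computable₂ g ∧ ∀ x, ∃ s₀, ∀ s ≥ s₀, g s x = f x

/-! ### The diagonal construction -/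

/-- A block of numbers below `s + 1` avoiding the restrained elements of `X`. -/
def dump (s : ℕ) (X : List (ℕ × ℕ)) : List ℕ :=
  0 :: (List.range (s + 1)).filter (fun z => z ∉ X.map Prod.fst)

/-- The least number that is neither a guard in `X` nor in `U` at stage `s`. -/
def freshGuard (U : ℕ → ℕ → Bool) (s : ℕ) (X : List (ℕ × ℕ)) : ℕ :=
  (List.range (s + X.length + 1)).findIdx (fun q => decide (q ∉ X.map Prod.snd) && !U s q)

/-- `w` codes a pair of an admissible extension of the current sequence and a new element
which passes the test `T`. -/
def isWitness (T : ℕ → List ℕ → ℕ → Bool) (s : ℕ) (p : List ℕ × List (ℕ × ℕ)) (w : ℕ) : Bool :=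
  let r := Denumerable.ofNat (List ℕ × ℕ) w
  decide (∀ z ∈ r.1, z ∉ p.2.map Prod.fst) && decide (r.2 ∉ p.1 ++ r.1) &&
    decide (r.2 ∉ p.2.map Prod.fst) && T s (p.1 ++ r.1) r.2

/-- One stage of the construction. A state consists of a finite sequence and a list of
restrained elements, each paired with its guard. -/
def advance (U : ℕ → ℕ → Bool) (T : ℕ → List ℕ → ℕ → Bool) (s : ℕ)
    (p : List ℕ × List (ℕ × ℕ)) : List ℕ × List (ℕ × ℕ) :=
  let j := p.2.findIdx (fun y => U s y.2)
  let w := (List.range s).findIdx (isWitness T s p)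
  let r := Denumerable.ofNat (List ℕ × ℕ) w
  let X := p.2 ++ [(r.2, freshGuard U s p.2)]
  if j < p.2.length then (p.1 ++ dump s (p.2.take j), p.2.take j)
  else if w < s then (p.1 ++ r.1 ++ dump s X, X)
  else p

/-- The state of the construction after `s` stages. -/
def run (U : ℕ → ℕ → Bool) (T : ℕ → List ℕ → ℕ → Bool) : ℕ → List ℕ × List (ℕ × ℕ)
  | 0 => ([0], [])
  | s + 1 => advance U T s (run U T s)

theorem primrecRel_mem {α : Type*} [Primcodable α] :
    PrimrecRel fun (l : List α) (a : α) => a ∈ l :=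
  (PrimrecRel.exists_mem_list (R := fun a b : α => a = b) Primrec.eq).of_eq fun l a => by simp

theorem primrecRel_notMem {α : Type*} [Primcodable α] :
    PrimrecRel fun (a : α) (l : List α) => a ∉ l :=
  (primrecRel_mem.not.swap : PrimrecRel fun (a : α) (l : List α) => ¬ a ∈ l)

theorem primrec_restrained : Primrec fun X : List (ℕ × ℕ) => X.map Prod.fst :=
  Primrec.list_map .id (Primrec.fst.comp .snd).to₂

theorem primrec_guards : Primrec fun X : List (ℕ × ℕ) => X.map Prod.snd :=
  Primrec.list_map .id (Primrec.snd.comp .snd).to₂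

theorem primrec_dump : Primrec₂ dump := by
  have h := (primrecRel_notMem (α := ℕ)).listFilter
  exact Primrec.list_cons.comp (.const 0) (h.comp
    (Primrec.list_range.comp (Primrec.succ.comp .fst)) (primrec_restrained.comp .snd))

section Primrec

variable {U : ℕ → ℕ → ℕ → Bool} {T : ℕ → ℕ → List ℕ → ℕ → Bool}

theorem primrec_freshGuard (hU : Primrec fun a : ℕ × ℕ × ℕ => U a.1 a.2.1 a.2.2) :
    Primrec fun a : ℕ × ℕ × List (ℕ × ℕ) => freshGuard (U a.1) a.2.1 a.2.2 := by
  refine Primrec.list_findIdx (Primrec.list_range.comp (Primrec.succ.comp (Primrec.nat_add.comp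
    (Primrec.fst.comp .snd) (Primrec.list_length.comp (Primrec.snd.comp .snd))))) ?_
  refine (Primrec.and.comp (PrimrecPred.decide (primrecRel_notMem.comp .snd
    (primrec_guards.comp (Primrec.snd.comp (Primrec.snd.comp .fst)))))
    (Primrec.not.comp (hU.comp ((Primrec.fst.comp .fst).pair
      ((Primrec.fst.comp (Primrec.snd.comp .fst)).pair .snd))))).to₂

theorem primrec_isWitness
    (hT : Primrec fun a : ℕ × ℕ × List ℕ × ℕ => T a.1 a.2.1 a.2.2.1 a.2.2.2) :
    Primrec fun a : (ℕ × ℕ × List ℕ × List (ℕ × ℕ)) × ℕ =>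
      isWitness (T a.1.1) a.1.2.1 a.1.2.2 a.2 := by
  have hr : Primrec fun a : (ℕ × ℕ × List ℕ × List (ℕ × ℕ)) × ℕ =>
      Denumerable.ofNat (List ℕ × ℕ) a.2 := (Primrec.ofNat _).comp .snd
  have hc : Primrec fun a : (ℕ × ℕ × List ℕ × List (ℕ × ℕ)) × ℕ => a.1.1 :=
    Primrec.fst.comp .fst
  have hs : Primrec fun a : (ℕ × ℕ × List ℕ × List (ℕ × ℕ)) × ℕ => a.1.2.1 :=
    Primrec.fst.comp (Primrec.snd.comp .fst)
  have hσ : Primrec fun a : (ℕ × ℕ × List ℕ × List (ℕ × ℕ)) × ℕ => a.1.2.2.1 :=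
    Primrec.fst.comp (Primrec.snd.comp (Primrec.snd.comp .fst))
  have hX : Primrec fun a : (ℕ × ℕ × List ℕ × List (ℕ × ℕ)) × ℕ => a.1.2.2.2.map Prod.fst :=
    primrec_restrained.comp (Primrec.snd.comp (Primrec.snd.comp (Primrec.snd.comp .fst)))
  have hτ := Primrec.list_append.comp hσ (Primrec.fst.comp hr)
  have hx := Primrec.snd.comp hr
  exact Primrec.and.comp (Primrec.and.comp (Primrec.and.comp
    (PrimrecPred.decide ((primrecRel_notMem (α := ℕ)).forall_mem_list.comp
      (Primrec.fst.comp hr) hX))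
    (PrimrecPred.decide (primrecRel_notMem.comp hx hτ)))
    (PrimrecPred.decide (primrecRel_notMem.comp hx hX)))
    (hT.comp (hc.pair (hs.pair (hτ.pair hx))))

theorem primrec_advance (hU : Primrec fun a : ℕ × ℕ × ℕ => U a.1 a.2.1 a.2.2)
    (hT : Primrec fun a : ℕ × ℕ × List ℕ × ℕ => T a.1 a.2.1 a.2.2.1 a.2.2.2) :
    Primrec fun a : ℕ × ℕ × List ℕ × List (ℕ × ℕ) => advance (U a.1) (T a.1) a.2.1 a.2.2 := by
  have hs : Primrec fun a : ℕ × ℕ × List ℕ × List (ℕ × ℕ) => a.2.1 := Primrec.fst.comp .snd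
  have hσ : Primrec fun a : ℕ × ℕ × List ℕ × List (ℕ × ℕ) => a.2.2.1 :=
    Primrec.fst.comp (Primrec.snd.comp .snd)
  have hX : Primrec fun a : ℕ × ℕ × List ℕ × List (ℕ × ℕ) => a.2.2.2 :=
    Primrec.snd.comp (Primrec.snd.comp .snd)
  have hj : Primrec fun a : ℕ × ℕ × List ℕ × List (ℕ × ℕ) =>
      a.2.2.2.findIdx (fun y => U a.1 a.2.1 y.2) :=
    Primrec.list_findIdx hX (hU.comp ((Primrec.fst.comp .fst).pair
      ((Primrec.fst.comp (Primrec.snd.comp .fst)).pair (Primrec.snd.comp .snd)))).to₂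
  have hw : Primrec fun a : ℕ × ℕ × List ℕ × List (ℕ × ℕ) =>
      (List.range a.2.1).findIdx (isWitness (T a.1) a.2.1 a.2.2) :=
    Primrec.list_findIdx (Primrec.list_range.comp hs) (primrec_isWitness hT).to₂
  have hr := (Primrec.ofNat (List ℕ × ℕ)).comp hw
  have hX' := Primrec.list_concat.comp hX ((Primrec.snd.comp hr).pair
    ((primrec_freshGuard hU).comp (Primrec.fst.pair (hs.pair hX))))
  have ht := Primrec.list_take.comp hj hX
  exact Primrec.ite (Primrec.nat_lt.comp hj (Primrec.list_length.comp hX))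
    ((Primrec.list_append.comp hσ (primrec_dump.comp hs ht)).pair ht)
    (Primrec.ite (Primrec.nat_lt.comp hw hs)
      ((Primrec.list_append.comp (Primrec.list_append.comp hσ (Primrec.fst.comp hr))
        (primrec_dump.comp hs hX')).pair hX') (Primrec.snd.comp .snd))

theorem primrec_run (hU : Primrec fun a : ℕ × ℕ × ℕ => U a.1 a.2.1 a.2.2)
    (hT : Primrec fun a : ℕ × ℕ × List ℕ × ℕ => T a.1 a.2.1 a.2.2.1 a.2.2.2) :
    Primrec₂ fun c s => run (U c) (T c) s := by
  have h := Primrec.nat_rec (f := fun _ : ℕ => (([0], []) : List ℕ × List (ℕ × ℕ)))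
    (g := fun c q => advance (U c) (T c) q.1 q.2) (.const _) (primrec_advance hU hT).to₂
  refine h.of_eq fun c s => ?_
  induction s with
  | zero => rfl
  | succ s ih => simp only [run, ← ih]

end Primrec

/-! ### Combinatorics of the construction -/

section Construction

variable {U : ℕ → ℕ → Bool} {T : ℕ → List ℕ → ℕ → Bool}

theorem mem_dump {s z : ℕ} {X : List (ℕ × ℕ)} :
    z ∈ dump s X ↔ z = 0 ∨ z ≤ s ∧ z ∉ X.map Prod.fst := by
  simp [dump]

theorem dump_ne_nil (s : ℕ) (X : List (ℕ × ℕ)) : dump s X ≠ [] := by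
  simp [dump]

theorem freshGuard_spec (hUb : ∀ s q, U s q = true → q < s) (s : ℕ) (X : List (ℕ × ℕ)) :
    freshGuard U s X ∉ X.map Prod.snd ∧ U s (freshGuard U s X) = false ∧
      ∀ q < freshGuard U s X, q ∈ X.map Prod.snd ∨ U s q = true := by
  set p : ℕ → Bool := fun q => decide (q ∉ X.map Prod.snd) && !U s q with hp
  have hex : ∃ q ∈ List.range (s + X.length + 1), p q = true := by
    by_contra! hcon
    have hsub : Finset.Icc s (s + X.length) ⊆ (X.map Prod.snd).toFinset := by
      intro q hq
      rw [Finset.mem_Icc] at hq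
      have h1 := hcon q (by simp; omega)
      have h2 : U s q = false := by
        by_contra h
        have := hUb s q (by simpa using h)
        omega
      rw [List.mem_toFinset]
      by_contra h3
      exact h1 (by simp only [hp, h2]; simpa using h3)
    have h1 := (Finset.card_le_card hsub).trans (List.toFinset_card_le _)
    simp at h1
    omega
  have hlt : (List.range (s + X.length + 1)).findIdx p <
      (List.range (s + X.length + 1)).length := List.findIdx_lt_length.2 hex
  have hg : p (freshGuard U s X) = true := by
    have := List.findIdx_getElem (w := hlt)
    rw [List.getElem_range] at this
    exact this
  have hmin : ∀ q < freshGuard U s X, p q = false := by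
    intro q hq
    have := List.not_of_lt_findIdx (p := p) (xs := List.range (s + X.length + 1)) hq
    simpa using this
  simp only [hp, Bool.and_eq_true, decide_eq_true_eq, Bool.not_eq_true'] at hg
  refine ⟨hg.1, hg.2, fun q hq => ?_⟩
  have := hmin q hq
  simp only [hp, Bool.and_eq_false_iff, decide_eq_false_iff_not, not_not,
    Bool.not_eq_false'] at this
  exact this

theorem advance_cases (U : ℕ → ℕ → Bool) (T : ℕ → List ℕ → ℕ → Bool) (s : ℕ)
    (p : List ℕ × List (ℕ × ℕ)) :
    (∃ j, ∃ hj : j < p.2.length, U s p.2[j].2 = true ∧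
      (∀ i, ∀ hi : i < p.2.length, U s p.2[i].2 = true → j ≤ i) ∧
      advance U T s p = (p.1 ++ dump s (p.2.take j), p.2.take j)) ∨
    ((∀ y ∈ p.2, U s y.2 = false) ∧ ∃ ρ x, (∀ z ∈ ρ, z ∉ p.2.map Prod.fst) ∧ x ∉ p.1 ++ ρ ∧
      x ∉ p.2.map Prod.fst ∧ T s (p.1 ++ ρ) x = true ∧
      advance U T s p = (p.1 ++ ρ ++ dump s (p.2 ++ [(x, freshGuard U s p.2)]),
        p.2 ++ [(x, freshGuard U s p.2)])) ∨
    ((∀ y ∈ p.2, U s y.2 = false) ∧ (∀ w < s, isWitness T s p w = false) ∧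
      advance U T s p = p) := by
  by_cases hj : p.2.findIdx (fun y => U s y.2) < p.2.length
  · refine Or.inl ⟨_, hj, List.findIdx_getElem (w := hj), fun i hi hU => ?_, ?_⟩
    · by_contra h
      have := List.not_of_lt_findIdx (not_le.1 h)
      simp [hU] at this
    · simp only [advance, if_pos hj]
  · have hno : ∀ y ∈ p.2, U s y.2 = false := by
      intro y hy
      by_contra h
      exact hj (List.findIdx_lt_length.2 ⟨y, hy, by simpa using h⟩)
    by_cases hw : (List.range s).findIdx (isWitness T s p) < s
    · refine Or.inr (Or.inl ⟨hno, ?_⟩)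
      have hwit := List.findIdx_getElem (p := isWitness T s p) (xs := List.range s)
        (w := by simpa using hw)
      rw [List.getElem_range] at hwit
      simp only [isWitness, Bool.and_eq_true, decide_eq_true_eq] at hwit
      exact ⟨_, _, hwit.1.1.1, hwit.1.1.2, hwit.1.2, hwit.2, by
        simp only [advance, if_neg hj, if_pos hw]⟩
    · refine Or.inr (Or.inr ⟨hno, fun w hws => ?_, by simp only [advance, if_neg hj, if_neg hw]⟩)
      by_contra h
      refine hw ?_
      have : (List.range s).findIdx (isWitness T s p) < (List.range s).length :=
        List.findIdx_lt_length.2 ⟨w, by simpa using hws, by simpa using h⟩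
      simpa using this

theorem run_succ_cases (U : ℕ → ℕ → Bool) (T : ℕ → List ℕ → ℕ → Bool) (s : ℕ) :
    (∃ j, ∃ hj : j < (run U T s).2.length, U s (run U T s).2[j].2 = true ∧
      (∀ i, ∀ hi : i < (run U T s).2.length, U s (run U T s).2[i].2 = true → j ≤ i) ∧
      run U T (s + 1) =
        ((run U T s).1 ++ dump s ((run U T s).2.take j), (run U T s).2.take j)) ∨
    ((∀ y ∈ (run U T s).2, U s y.2 = false) ∧ ∃ ρ x,
      (∀ z ∈ ρ, z ∉ (run U T s).2.map Prod.fst) ∧ x ∉ (run U T s).1 ++ ρ ∧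
      x ∉ (run U T s).2.map Prod.fst ∧ T s ((run U T s).1 ++ ρ) x = true ∧
      run U T (s + 1) =
        ((run U T s).1 ++ ρ ++ dump s ((run U T s).2 ++ [(x, freshGuard U s (run U T s).2)]),
        (run U T s).2 ++ [(x, freshGuard U s (run U T s).2)])) ∨
    ((∀ y ∈ (run U T s).2, U s y.2 = false) ∧ (∀ w < s, isWitness T s (run U T s) w = false) ∧
      run U T (s + 1) = run U T s) :=
  advance_cases U T s (run U T s)

/-- The set of all numbers that ever enter the sequence. -/
def limitSet (U : ℕ → ℕ → Bool) (T : ℕ → List ℕ → ℕ → Bool) : Set ℕ :=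
  {z | ∃ s, z ∈ (run U T s).1}

/-- `P` is from some stage on an initial segment of the list of restrained elements. -/
def Settled (U : ℕ → ℕ → Bool) (T : ℕ → List ℕ → ℕ → Bool) (P : List (ℕ × ℕ)) : Prop :=
  ∃ s₀, ∀ s ≥ s₀, P <+: (run U T s).2

/-- The construction is eventually constant. -/
def Stuck (U : ℕ → ℕ → Bool) (T : ℕ → List ℕ → ℕ → Bool) : Prop :=
  ∃ s₀, ∀ s ≥ s₀, run U T s = run U T s₀

theorem run_mono_succ (s : ℕ) : (run U T s).1 <+: (run U T (s + 1)).1 := by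
  rcases run_succ_cases U T s with ⟨j, hj, -, -, h⟩ | ⟨-, ρ, x, -, -, -, -, h⟩ | ⟨-, -, h⟩ <;>
    rw [h] <;> simp [List.append_assoc]

theorem run_mono {s t : ℕ} (h : s ≤ t) : (run U T s).1 <+: (run U T t).1 := by
  induction t, h using Nat.le_induction with
  | base => exact List.prefix_rfl
  | succ t _ ih => exact ih.trans (run_mono_succ t)

theorem zero_mem_run (s : ℕ) : 0 ∈ (run U T s).1 :=
  (run_mono (Nat.zero_le s)).subset (by simp [run])

theorem run_disjoint (s : ℕ) :
    ∀ x ∈ (run U T s).2.map Prod.fst, x ∉ (run U T s).1 := by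
  induction s with
  | zero => simp [run]
  | succ s ih =>
    have h0 := zero_mem_run (U := U) (T := T) s
    rcases run_succ_cases U T s with ⟨j, hj, -, -, h⟩ | ⟨-, ρ, x, h1, h2, h3, -, h⟩ | ⟨-, -, h⟩ <;>
      rw [h]
    · intro z hz hz'
      have hz1 : z ∈ (run U T s).2.map Prod.fst := by
        rw [List.map_take] at hz
        exact List.mem_of_mem_take hz
      have hz2 := ih z hz1
      rcases List.mem_append.1 hz' with hz' | hz'
      · exact hz2 hz'
      · rcases mem_dump.1 hz' with rfl | ⟨-, hz'⟩
        · exact hz2 h0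
        · exact hz' hz
    · intro z hz hz'
      have hz2 : z ∉ (run U T s).1 ++ ρ := by
        rw [List.map_append, List.mem_append] at hz
        rcases hz with hz | hz
        · rw [List.mem_append, not_or]
          exact ⟨ih z hz, fun h => h1 z h hz⟩
        · simp only [List.map_cons, List.map_nil, List.mem_singleton] at hz
          exact hz ▸ h2
      rcases List.mem_append.1 hz' with hz' | hz'
      · exact hz2 hz'
      · rcases mem_dump.1 hz' with rfl | ⟨-, hz'⟩
        · exact hz2 (List.mem_append_left _ h0)
        · exact hz' hz
    · exact ih

theorem run_guards_nodup (hUb : ∀ s q, U s q = true → q < s) (s : ℕ) :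
    ((run U T s).2.map Prod.snd).Nodup := by
  induction s with
  | zero => simp [run]
  | succ s ih =>
    rcases run_succ_cases U T s with ⟨j, hj, -, -, h⟩ | ⟨-, ρ, x, h1, h2, h3, -, h⟩ | ⟨-, -, h⟩ <;>
      rw [h]
    · rw [List.map_take]
      exact ih.sublist (List.take_sublist _ _)
    · have := (freshGuard_spec hUb s (run U T s).2).1
      rw [List.map_append, List.map_cons, List.map_nil, List.nodup_append]
      refine ⟨ih, by simp, ?_⟩
      rintro a ha b hb rfl
      rw [List.mem_singleton] at hb
      have hb' : a = freshGuard U s (run U T s).2 := hb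
      rw [hb'] at ha
      exact this ha
    · exact ih

theorem run_succ_eq_or_length_lt (s : ℕ) :
    run U T (s + 1) = run U T s ∨ (run U T s).1.length < (run U T (s + 1)).1.length := by
  rcases run_succ_cases U T s with ⟨j, hj, -, -, h⟩ | ⟨-, ρ, x, h1, h2, h3, -, h⟩ | ⟨-, -, h⟩
  · right
    have := List.length_pos_iff.2 (dump_ne_nil s ((run U T s).2.take j))
    rw [h, List.length_append]
    omega
  · right
    have := List.length_pos_iff.2 (dump_ne_nil s ((run U T s).2 ++ [(x, freshGuard U s (run U T s).2)]))
    rw [h, List.length_append, List.length_append]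
    omega
  · exact Or.inl h

theorem exists_length_ge (hns : ¬ Stuck U T) (n : ℕ) : ∃ s, n ≤ (run U T s).1.length := by
  induction n with
  | zero => exact ⟨0, Nat.zero_le _⟩
  | succ n ih =>
    obtain ⟨s, hs⟩ := ih
    by_contra! hcon
    refine hns ⟨s, fun t ht => ?_⟩
    induction t, ht using Nat.le_induction with
    | base => rfl
    | succ t ht ih =>
      rcases run_succ_eq_or_length_lt (U := U) (T := T) t with h | h
      · rw [h, ih]
      · have h1 := (run_mono (U := U) (T := T) ht).length_le
        have h2 := hcon (t + 1)
        omega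

theorem length_restrained_le (s : ℕ) : (run U T s).2.length ≤ s := by
  induction s with
  | zero => simp [run]
  | succ s ih =>
    rcases run_succ_cases U T s with ⟨j, hj, -, -, h⟩ | ⟨-, ρ, x, h1, h2, h3, -, h⟩ | ⟨-, -, h⟩ <;>
      rw [h]
    · simp only [List.length_take]
      omega
    · simp only [List.length_append, List.length_singleton]
      omega
    · omega

theorem Stuck.limitSet_eq {s₀ : ℕ} (h : ∀ s ≥ s₀, run U T s = run U T s₀) :
    limitSet U T = {z | z ∈ (run U T s₀).1} := by
  ext z
  refine ⟨fun ⟨s, hs⟩ => ?_, fun hz => ⟨s₀, hz⟩⟩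
  have := (run_mono (U := U) (T := T) (le_max_left s s₀)).subset hs
  rwa [h _ (le_max_right _ _)] at this

theorem Settled.notMem_limitSet {P : List (ℕ × ℕ)} (hP : Settled U T P) {z : ℕ}
    (hz : z ∈ P.map Prod.fst) : z ∉ limitSet U T := by
  rintro ⟨s, hs⟩
  obtain ⟨s₀, h⟩ := hP
  exact run_disjoint (max s s₀) z (((h _ (le_max_right _ _)).map Prod.fst).subset hz)
    ((run_mono (le_max_left _ _)).subset hs)

/-- A stage acts on a restrained initial segment only if one of its guards enters `U`. -/
theorem prefix_succ_or_guard {P : List (ℕ × ℕ)} {s : ℕ} (hP : P <+: (run U T s).2) :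
    P <+: (run U T (s + 1)).2 ∨ ∃ y ∈ P, U s y.2 = true := by
  rcases run_succ_cases U T s with ⟨j, hj, hU, -, h⟩ | ⟨-, ρ, x, h1, h2, h3, -, h⟩ | ⟨-, -, h⟩
  · by_cases hjP : j < P.length
    · refine Or.inr ⟨P[j], List.getElem_mem hjP, ?_⟩
      rwa [hP.getElem hjP]
    · left
      rw [h, List.prefix_take_iff]
      exact ⟨hP, not_lt.1 hjP⟩
  · left
    rw [h]
    exact hP.trans (List.prefix_append _ _)
  · left
    rwa [h]

theorem Settled.guard {P : List (ℕ × ℕ)} (hUm : ∀ s t q, s ≤ t → U s q = true → U t q = true)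
    (hP : Settled U T P) {y : ℕ × ℕ} (hy : y ∈ P) (s : ℕ) : U s y.2 = false := by
  by_contra hU
  obtain ⟨s₀, h⟩ := hP
  have hP1 := h _ (le_max_right s s₀)
  have hP2 := h (max s s₀ + 1) ((le_max_right s s₀).trans (Nat.le_succ _))
  have hU1 := hUm _ _ _ (le_max_left s s₀) (by simpa using hU)
  obtain ⟨i, hi, rfl⟩ := List.getElem_of_mem hy
  rcases run_succ_cases U T (max s s₀) with
    ⟨j, hj, -, hmin, h⟩ | ⟨hno, -⟩ | ⟨hno, -⟩
  · rw [hP1.getElem hi] at hU1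
    have := hmin i (hi.trans_le hP1.length_le) hU1
    have h2 := hP2.length_le
    rw [h, List.length_take] at h2
    omega
  · rw [hno _ (hP1.subset hy)] at hU1
    cases hU1
  · rw [hno _ (hP1.subset hy)] at hU1
    cases hU1

theorem settled_nil : Settled U T [] := ⟨0, fun _ _ => List.nil_prefix⟩

/-- A maximal settled list is the list of restrained elements at infinitely many stages. -/
theorem exists_restrained_eq {P : List (ℕ × ℕ)} (hP : Settled U T P)
    (hmax : ∀ y, ¬ Settled U T (P ++ [y])) (t : ℕ) : ∃ s ≥ t, (run U T s).2 = P := by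
  by_contra! hcon
  obtain ⟨s₀, h⟩ := hP
  have hlt : ∀ s ≥ max t s₀, P.length < (run U T s).2.length := by
    intro s hs
    have h1 := h s ((le_max_right _ _).trans hs)
    refine lt_of_le_of_ne h1.length_le fun he => ?_
    exact hcon s ((le_max_left _ _).trans hs) (h1.eq_of_length he).symm
  have hext : ∀ s ≥ max t s₀, ∀ hs : P.length < (run U T s).2.length,
      P ++ [(run U T s).2[P.length]] <+: (run U T s).2 := by
    intro s hs hs'
    obtain ⟨l, hl⟩ := h s ((le_max_right _ _).trans hs)
    cases l with
    | nil =>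
      rw [← hl, List.append_nil] at hs'
      exact absurd hs' (lt_irrefl _)
    | cons a l => exact ⟨l, by simp [← hl]⟩
  have hs₁ := hlt _ le_rfl
  refine hmax ((run U T (max t s₀)).2[P.length]) ⟨max t s₀, fun s hs => ?_⟩
  induction s, hs using Nat.le_induction with
  | base => exact hext _ le_rfl hs₁
  | succ s hs ih =>
    have hlen := hlt (s + 1) (hs.trans (Nat.le_succ _))
    rcases run_succ_cases U T s with ⟨j, hj, hU, -, he⟩ | ⟨-, ρ, x, h1, h2, h3, -, he⟩ | ⟨-, -, he⟩
    · rw [he, List.length_take] at hlen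
      rw [he, List.prefix_take_iff]
      refine ⟨ih, ?_⟩
      simp only [List.length_append, List.length_singleton]
      omega
    · rw [he]
      exact ih.trans (List.prefix_append _ _)
    · rwa [he]

theorem exists_crossing {p : ℕ → Prop} {s t : ℕ} (hst : s ≤ t) (hs : p s) (ht : ¬ p t) :
    ∃ r, s ≤ r ∧ p r ∧ ¬ p (r + 1) := by
  by_contra! hcon
  exact ht (Nat.le_induction hs (fun n hn ih => hcon n hn ih) t hst)

/-- Unless the construction is stuck, any state of the restrained list is left later. -/
theorem exists_leave (hns : ¬ Stuck U T) {P : List (ℕ × ℕ)} {s : ℕ}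
    (hs : (run U T s).2 = P) : ∃ r ≥ s, (run U T r).2 = P ∧ (run U T (r + 1)).2 ≠ P := by
  suffices h : ∃ t ≥ s, (run U T t).2 ≠ P by
    obtain ⟨t, hst, ht⟩ := h
    exact exists_crossing (p := fun r => (run U T r).2 = P) hst hs ht
  by_contra! hcon
  refine hns ⟨s, fun t ht => ?_⟩
  induction t, ht using Nat.le_induction with
  | base => rfl
  | succ t ht ih =>
    have h1 := hcon t ht
    have h2 := hcon (t + 1) (ht.trans (Nat.le_succ _))
    rw [← ih]
    rcases run_succ_cases U T t with ⟨j, hj, hU, -, he⟩ | ⟨-, ρ, x, -, -, -, -, he⟩ | ⟨-, -, he⟩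
    · have := congrArg List.length (h2.trans h1.symm)
      rw [he, List.length_take] at this
      omega
    · have := congrArg List.length (h2.trans h1.symm)
      rw [he] at this
      simp at this
    · exact he

/-- The limit set is the complement of a maximal settled list. -/
theorem mem_limitSet_of_maximal (hns : ¬ Stuck U T) {P : List (ℕ × ℕ)} (hP : Settled U T P)
    (hmax : ∀ y, ¬ Settled U T (P ++ [y])) {z : ℕ} (hz : z ∉ P.map Prod.fst) :
    z ∈ limitSet U T := by
  have hP' := hP
  obtain ⟨s₀, h⟩ := hP'
  obtain ⟨s₁, hs₁, he₁⟩ := exists_restrained_eq hP hmax (max z s₀)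
  obtain ⟨s₂, hs₂, -, he₂⟩ := exists_leave hns he₁
  obtain ⟨s₃, hs₃, he₃⟩ := exists_restrained_eq hP hmax (s₂ + 1)
  obtain ⟨r, hr, hr1, hr2⟩ := exists_crossing (p := fun r => (run U T r).2 ≠ P) hs₃ he₂
    (not_not.2 he₃)
  rw [not_not] at hr2
  have hPr := h r (by omega)
  have hlt : P.length < (run U T r).2.length :=
    lt_of_le_of_ne hPr.length_le fun he => hr1 (hPr.eq_of_length he).symm
  rcases run_succ_cases U T r with ⟨j, hj, hU, -, he⟩ | ⟨-, ρ, x, -, -, -, -, he⟩ | ⟨-, -, he⟩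
  · have he' : (run U T r).2.take j = P := by rw [← hr2, he]
    refine ⟨r + 1, ?_⟩
    rw [he, he']
    exact List.mem_append_right _ (mem_dump.2 (Or.inr ⟨by omega, hz⟩))
  · have := congrArg List.length hr2
    rw [he] at this
    simp at this
    omega
  · exact absurd (he ▸ hr2) hr1

/-- If infinitely many numbers stay out of `U`, then settled lists can be extended. -/
theorem Settled.exists_extend (hUm : ∀ s t q, s ≤ t → U s q = true → U t q = true)
    (hUb : ∀ s q, U s q = true → q < s) (hns : ¬ Stuck U T)
    (hinf : {q | ∀ s, U s q = false}.Infinite) {P : List (ℕ × ℕ)} (hP : Settled U T P) :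
    ∃ y, Settled U T (P ++ [y]) := by
  by_contra! hmax
  obtain ⟨q, hq, hqP⟩ := hinf.exists_notMem_finset (P.map Prod.snd).toFinset
  rw [List.mem_toFinset] at hqP
  obtain ⟨t, ht⟩ : ∃ t, ∀ r < q, (∃ s, U s r = true) → U t r = true := by
    clear hq hqP
    induction q with
    | zero => exact ⟨0, by simp⟩
    | succ q ih =>
      obtain ⟨t, ht⟩ := ih
      by_cases h : ∃ s, U s q = true
      · obtain ⟨s, hs⟩ := h
        refine ⟨max s t, fun r hr hr' => ?_⟩
        rcases Nat.lt_succ_iff_lt_or_eq.1 hr with hr | rfl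
        · exact hUm _ _ _ (le_max_right _ _) (ht r hr hr')
        · exact hUm _ _ _ (le_max_left _ _) hs
      · refine ⟨t, fun r hr hr' => ?_⟩
        rcases Nat.lt_succ_iff_lt_or_eq.1 hr with hr | rfl
        · exact ht r hr hr'
        · exact absurd hr' h
  have hP' := hP
  obtain ⟨s₀, h⟩ := hP'
  obtain ⟨s₁, hs₁, he₁⟩ := exists_restrained_eq hP hmax (max t s₀)
  obtain ⟨r, hr, hr1, hr2⟩ := exists_leave hns he₁
  rcases run_succ_cases U T r with ⟨j, hj, hU, -, he⟩ | ⟨-, ρ, x, -, -, -, -, he⟩ | ⟨-, -, he⟩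
  · have := (h (r + 1) (by omega)).length_le
    rw [he, List.length_take] at this
    rw [hr1] at this hj
    omega
  · rw [hr1] at he
    obtain ⟨hg1, hg2, hg3⟩ := freshGuard_spec hUb r P
    set g := freshGuard U r P
    have hgq : g ≤ q := by
      by_contra hlt
      rcases hg3 q (not_le.1 hlt) with h' | h'
      · exact hqP h'
      · rw [hq r] at h'
        cases h'
    have hgU : ∀ s, U s g = false := by
      intro s
      by_contra hs
      rcases hgq.lt_or_eq with hlt | heq
      · have h1 := ht g hlt ⟨s, by simpa using hs⟩
        rw [hUm t r g (by omega) h1] at hg2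
        cases hg2
      · exact hs (heq ▸ hq s)
    refine hmax (x, g) ⟨r + 1, fun s hs => ?_⟩
    induction s, hs using Nat.le_induction with
    | base => rw [he]
    | succ s hs ih =>
      rcases prefix_succ_or_guard ih with h' | ⟨y, hy, hy'⟩
      · exact h'
      · rcases List.mem_append.1 hy with hy | hy
        · rw [hP.guard hUm hy s] at hy'
          cases hy'
        · rw [List.mem_singleton.1 hy, hgU s] at hy'
          cases hy'
  · exact hr2 (he ▸ hr1)

theorem exists_settled_length (hUm : ∀ s t q, s ≤ t → U s q = true → U t q = true)
    (hUb : ∀ s q, U s q = true → q < s) (hns : ¬ Stuck U T)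
    (hinf : {q | ∀ s, U s q = false}.Infinite) (n : ℕ) :
    ∃ P, Settled U T P ∧ P.length = n := by
  induction n with
  | zero => exact ⟨[], settled_nil, rfl⟩
  | succ n ih =>
    obtain ⟨P, hP, hn⟩ := ih
    obtain ⟨y, hy⟩ := hP.exists_extend hUm hUb hns hinf
    exact ⟨_, hy, by simp [hn]⟩

/-- If only finitely many numbers stay out of `U`, there is a maximal settled list. -/
theorem exists_maximal_settled (hUm : ∀ s t q, s ≤ t → U s q = true → U t q = true)
    (hUb : ∀ s q, U s q = true → q < s)
    (hfin : {q | ∀ s, U s q = false}.Finite) :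
    ∃ P, Settled U T P ∧ ∀ y, ¬ Settled U T (P ++ [y]) := by
  by_contra! hcon
  have hall : ∀ n, ∃ P, Settled U T P ∧ P.length = n := by
    intro n
    induction n with
    | zero => exact ⟨[], settled_nil, rfl⟩
    | succ n ih =>
      obtain ⟨P, hP, hn⟩ := ih
      obtain ⟨y, hy⟩ := hcon P hP
      exact ⟨_, hy, by simp [hn]⟩
  obtain ⟨P, hP, hn⟩ := hall (hfin.toFinset.card + 1)
  have hsub : (P.map Prod.snd).toFinset ⊆ hfin.toFinset := by
    intro q hq
    rw [List.mem_toFinset, List.mem_map] at hq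
    obtain ⟨y, hy, rfl⟩ := hq
    simpa using fun s => hP.guard hUm hy s
  have hnd : (P.map Prod.snd).Nodup := by
    have hP' := hP
    obtain ⟨s₀, h⟩ := hP'
    exact (run_guards_nodup hUb s₀).sublist ((h s₀ le_rfl).map Prod.snd).sublist
  have := Finset.card_le_card hsub
  rw [List.toFinset_card_of_nodup hnd, List.length_map, hn] at this
  omega

/-- Each settled element was put in at a stage where its test succeeded. -/
theorem exists_test_of_settled (hns : ¬ Stuck U T)
    (hall : ∀ n, ∃ P, Settled U T P ∧ P.length = n) (n : ℕ) :
    ∃ s τ x, n ≤ τ.length ∧ τ <+: (run U T s).1 ∧ x ∉ limitSet U T ∧ ∃ t, T t τ x = true := by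
  obtain ⟨t, ht⟩ := exists_length_ge hns n
  obtain ⟨P, hP, hPn⟩ := hall (t + 1)
  have hPt : ¬ P <+: (run U T t).2 := fun h => by
    have h1 := h.length_le
    have h2 := length_restrained_le (U := U) (T := T) t
    omega
  have hP' := hP
  obtain ⟨s₀, h⟩ := hP'
  obtain ⟨r, hr, hr1, hr2⟩ := exists_crossing (p := fun r => ¬ P <+: (run U T r).2)
    (le_max_left t s₀) hPt (not_not.2 (h _ (le_max_right _ _)))
  rw [not_not] at hr2
  rcases run_succ_cases U T r with ⟨j, hj, hU, -, he⟩ | ⟨-, ρ, x, -, -, -, hT, he⟩ | ⟨-, -, he⟩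
  · rw [he, List.prefix_take_iff] at hr2
    exact absurd hr2.1 hr1
  · have hr3 := hr2
    rw [he, List.prefix_concat_iff] at hr3
    have hPe := hr3.resolve_right hr1
    refine ⟨r + 1, (run U T r).1 ++ ρ, x, ?_, ?_, ?_, r, hT⟩
    · rw [List.length_append]
      have := (run_mono (U := U) (T := T) hr).length_le
      omega
    · rw [he]
      exact List.prefix_append _ _
    · exact hP.notMem_limitSet (by rw [hPe]; simp)
  · exact absurd (he ▸ hr2) hr1

/-- If the construction is stuck, no admissible extension passes the test. -/
theorem Stuck.test_eq_false (hTm : ∀ s t τ x, s ≤ t → T s τ x = true → T t τ x = true)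
    {s₀ : ℕ} (h : ∀ s ≥ s₀, run U T s = run U T s₀) {ρ : List ℕ} {x : ℕ}
    (h1 : ∀ z ∈ ρ, z ∉ (run U T s₀).2.map Prod.fst) (h2 : x ∉ (run U T s₀).1 ++ ρ)
    (h3 : x ∉ (run U T s₀).2.map Prod.fst) (t : ℕ) :
    T t ((run U T s₀).1 ++ ρ) x = false := by
  by_contra hT
  set w := Encodable.encode (ρ, x) with hw
  set r := max (max s₀ t) (w + 1) with hr
  have hr1 : s₀ ≤ r := (le_max_left _ _).trans (le_max_left _ _)
  have hr2 : t ≤ r := (le_max_right _ _).trans (le_max_left _ _)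
  have hr3 : w < r := Nat.lt_of_succ_le (le_max_right _ _)
  have hwit : isWitness T r (run U T r) w = true := by
    rw [h r hr1]
    simp only [isWitness, hw, Denumerable.ofNat_encode, Bool.and_eq_true, decide_eq_true_eq]
    exact ⟨⟨⟨h1, h2⟩, h3⟩, hTm _ _ _ _ hr2 (by simpa using hT)⟩
  have hrun : run U T (r + 1) = run U T r := by
    rw [h r hr1, h (r + 1) (by omega)]
  rcases run_succ_cases U T r with ⟨j, hj, hU, -, he⟩ | ⟨-, ρ, x, -, -, -, hT, he⟩ | ⟨-, hno, -⟩
  · have := congrArg (fun p => p.2.length) (he.symm.trans hrun)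
    simp at this
    omega
  · have := congrArg (fun p => p.2.length) (he.symm.trans hrun)
    simp at this
  · rw [hno w hr3] at hwit
    cases hwit

end Construction

/-! ### Texts -/

theorem mem_initSeg {f : ℕ → ℕ} {n x : ℕ} : x ∈ initSeg f n ↔ ∃ k < n, f k = x := by
  simp [initSeg]

theorem length_initSeg (f : ℕ → ℕ) (n : ℕ) : (initSeg f n).length = n := by
  simp [initSeg]

theorem exists_subset_initSeg {f : ℕ → ℕ} {l : List ℕ} (hl : ∀ z ∈ l, z ∈ Set.range f) :
    ∃ N, ∀ n ≥ N, ∀ z ∈ l, z ∈ initSeg f n := by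
  induction l with
  | nil => exact ⟨0, by simp⟩
  | cons a l ih =>
    obtain ⟨N, hN⟩ := ih fun z hz => hl z (List.mem_cons_of_mem _ hz)
    obtain ⟨k, hk⟩ := hl a List.mem_cons_self
    refine ⟨max N (k + 1), fun n hn z hz => ?_⟩
    rcases List.mem_cons.1 hz with rfl | hz
    · exact mem_initSeg.2 ⟨k, by omega, hk⟩
    · exact hN n ((le_max_left _ _).trans hn) z hz

/-- The increasing union of the sequences of the construction is a text for the limit set. -/
theorem exists_limit_text {U : ℕ → ℕ → Bool} {T : ℕ → List ℕ → ℕ → Bool} (hns : ¬ Stuck U T) :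
    ∃ g : ℕ → ℕ, Set.range g = limitSet U T ∧
      ∀ s τ, τ <+: (run U T s).1 → initSeg g τ.length = τ := by
  choose S hS using fun n => exists_length_ge hns (n + 1)
  have key : ∀ s n, ∀ h : n < (run U T s).1.length,
      (run U T (S n)).1[n]'(hS n) = (run U T s).1[n] := by
    intro s n h
    rcases le_total s (S n) with hs | hs
    · exact ((run_mono hs).getElem h).symm
    · exact (run_mono hs).getElem _
  refine ⟨fun n => (run U T (S n)).1[n]'(hS n), ?_, fun s τ hτ => ?_⟩
  · ext z
    constructor
    · rintro ⟨n, rfl⟩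
      exact ⟨S n, List.getElem_mem _⟩
    · rintro ⟨s, hs⟩
      obtain ⟨n, hn, rfl⟩ := List.getElem_of_mem hs
      exact ⟨n, key s n hn⟩
  · refine List.ext_getElem (length_initSeg _ _) fun n h1 h2 => ?_
    simp only [initSeg, List.getElem_map, List.getElem_range]
    rw [key s n (h2.trans_le hτ.length_le), hτ.getElem h2]

/-- A finite sequence avoiding `X` extends to a text of the complement of `X`. -/
theorem exists_compl_text {σ X : List ℕ} (h0 : 0 ∈ σ) (hX : ∀ z ∈ σ, z ∉ X) :
    ∃ g : ℕ → ℕ, Set.range g = {z | z ∉ X} ∧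
      ∀ n ≥ σ.length, ∃ ρ : List ℕ, (∀ z ∈ ρ, z ∉ X) ∧ initSeg g n = σ ++ ρ := by
  set e : ℕ → ℕ := fun n => if n ∈ X then 0 else n with he
  have heX : ∀ n, e n ∉ X := by
    intro n
    by_cases h : n ∈ X
    · simpa [he, h] using hX 0 h0
    · simp [he, h]
  set g : ℕ → ℕ := fun n => if h : n < σ.length then σ[n] else e (n - σ.length) with hg
  have hge : ∀ n, g (σ.length + n) = e n := fun n => by simp [hg]
  refine ⟨g, ?_, fun n hn => ?_⟩
  · ext z
    constructor
    · rintro ⟨n, rfl⟩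
      by_cases h : n < σ.length
      · simpa [hg, h] using hX _ (List.getElem_mem h)
      · simpa [hg, h] using heX (n - σ.length)
    · intro hz
      refine ⟨σ.length + z, ?_⟩
      rw [hge]
      exact if_neg hz
  · obtain ⟨k, rfl⟩ := Nat.exists_eq_add_of_le hn
    refine ⟨(List.range k).map e, ?_, ?_⟩
    · intro z hz
      obtain ⟨n, -, rfl⟩ := List.mem_map.1 hz
      exact heX n
    · rw [initSeg, List.range_add, List.map_append, List.map_map]
      congr 1
      · refine List.ext_getElem (by simp) fun n h1 h2 => ?_
        simp [hg, h2]
      · exact List.map_congr_left fun n _ => hge n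

/-! ### The family and its learner, without tags -/

section Family

variable {U : ℕ → ℕ → Bool} {T : ℕ → List ℕ → ℕ → Bool}

/-- The family of the construction: the limit set, and for every stage `s` the complement of the
elements restrained at stage `s`, replaced by `ℕ` if the state changes later. -/
def familySet (U : ℕ → ℕ → Bool) (T : ℕ → List ℕ → ℕ → Bool) : ℕ → Set ℕ
  | 0 => limitSet U T
  | s + 1 => {z | z ∉ (run U T s).2.map Prod.fst ∨ ∃ t ≥ s, run U T t ≠ run U T s}

/-- The set conjectured after having seen the finite sequence `l`. -/
def conjecture (U : ℕ → ℕ → Bool) (T : ℕ → List ℕ → ℕ → Bool) (l : List ℕ) : Set ℕ :=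
  {z | z ∈ limitSet U T ∨
    ¬ ((∀ x ∈ l, x ∈ (run U T l.length).1) ∧ ∀ x ∈ (run U T l.length).1, x ∈ l) ∧
    (((run U T l.length).2.map Prod.fst).headI ∈ l ∨ z ∉ (run U T l.length).2.map Prod.fst)}

theorem limitSet_subset_conjecture (l : List ℕ) : limitSet U T ⊆ conjecture U T l :=
  fun _ hz => Or.inl hz

theorem familySet_succ_of_not_stuck (hns : ¬ Stuck U T) (s : ℕ) :
    familySet U T (s + 1) = Set.univ := by
  refine Set.eq_univ_of_forall fun z => Or.inr ?_
  by_contra! h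
  exact hns ⟨s, h⟩

theorem conjecture_eq_of_stuck (h : Stuck U T) (i : ℕ) {g : ℕ → ℕ}
    (hg : Set.range g = familySet U T i) :
    ∃ N, ∀ n ≥ N, conjecture U T (initSeg g n) = Set.range g := by
  obtain ⟨s₀, h⟩ := h
  have hL := Stuck.limitSet_eq h
  have hdisj := run_disjoint (U := U) (T := T) s₀
  have h0 := zero_mem_run (U := U) (T := T) s₀
  have hconj : ∀ n ≥ s₀, conjecture U T (initSeg g n) = {z | z ∈ (run U T s₀).1 ∨
      ¬ ((∀ x ∈ initSeg g n, x ∈ (run U T s₀).1) ∧ ∀ x ∈ (run U T s₀).1, x ∈ initSeg g n) ∧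
      (((run U T s₀).2.map Prod.fst).headI ∈ initSeg g n ∨
        z ∉ (run U T s₀).2.map Prod.fst)} := by
    intro n hn
    simp only [conjecture, length_initSeg, h n hn, hL, Set.mem_ofPred_eq]
  by_cases hgL : Set.range g = limitSet U T
  · obtain ⟨N, hN⟩ := exists_subset_initSeg (f := g) (l := (run U T s₀).1)
      (fun z hz => by rw [hgL, hL]; exact hz)
    refine ⟨max N s₀, fun n hn => ?_⟩
    rw [hconj n ((le_max_right _ _).trans hn), hgL, hL]
    ext z
    refine ⟨fun hz => hz.resolve_right fun hz => hz.1 ⟨fun x hx => ?_, ?_⟩, Or.inl⟩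
    · obtain ⟨k, -, rfl⟩ := mem_initSeg.1 hx
      have : g k ∈ limitSet U T := hgL ▸ Set.mem_range_self k
      rwa [hL] at this
    · exact hN n ((le_max_left _ _).trans hn)
  · have hcases : Set.range g = Set.univ ∨
        Set.range g = {z | z ∉ (run U T s₀).2.map Prod.fst} := by
      cases i with
      | zero => exact absurd hg hgL
      | succ s =>
        by_cases hc : ∃ t ≥ s, run U T t ≠ run U T s
        · left
          rw [hg]
          exact Set.eq_univ_of_forall fun z => Or.inr hc
        · right
          have hc' := hc
          push Not at hc'
          have he : run U T s = run U T s₀ := by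
            rw [← hc' _ (le_max_left s s₀), h _ (le_max_right s s₀)]
          rw [hg]
          ext z
          simp only [familySet, Set.mem_ofPred_eq, he]
          rw [he] at hc
          exact or_iff_left hc
    have hsub : {z | z ∉ (run U T s₀).2.map Prod.fst} ⊆ Set.range g := by
      rcases hcases with hc | hc <;> rw [hc]
      exact Set.subset_univ _
    have hfin : {z | z ∈ (run U T s₀).2.map Prod.fst}.Finite := List.finite_toSet _
    have hinf : (Set.range g).Infinite := (hfin.infinite_compl).mono hsub
    obtain ⟨x, hxg, hxσ⟩ := hinf.exists_notMem_finset (run U T s₀).1.toFinset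
    rw [List.mem_toFinset] at hxσ
    have hdiff : ∀ n, x ∈ initSeg g n → ¬ ((∀ x ∈ initSeg g n, x ∈ (run U T s₀).1) ∧
        ∀ x ∈ (run U T s₀).1, x ∈ initSeg g n) := fun n hx hc => hxσ (hc.1 x hx)
    rcases hcases with hc | hc
    · obtain ⟨N, hN⟩ := exists_subset_initSeg (f := g)
        (l := [x, ((run U T s₀).2.map Prod.fst).headI]) (by simp [hc])
      refine ⟨max N s₀, fun n hn => ?_⟩
      have hN' := hN n ((le_max_left _ _).trans hn)
      rw [hconj n ((le_max_right _ _).trans hn), hc]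
      exact Set.eq_univ_of_forall fun z =>
        Or.inr ⟨hdiff n (hN' _ (by simp)), Or.inl (hN' _ (by simp))⟩
    · obtain ⟨N, hN⟩ := exists_subset_initSeg (f := g) (l := [x])
        (by simpa using hxg)
      refine ⟨max N s₀, fun n hn => ?_⟩
      have hN' := hN n ((le_max_left _ _).trans hn)
      rw [hconj n ((le_max_right _ _).trans hn)]
      rw [hc]
      ext z
      constructor
      · rintro (hz | ⟨-, hz | hz⟩)
        · exact fun hz' => hdisj z hz' hz
        · obtain ⟨k, -, hk⟩ := mem_initSeg.1 hz
          have hk' : g k ∈ {z | z ∉ (run U T s₀).2.map Prod.fst} := hc ▸ Set.mem_range_self k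
          rw [hk] at hk'
          cases hX : (run U T s₀).2.map Prod.fst with
          | nil => simp
          | cons a l =>
            rw [hX] at hk'
            simp at hk'
        · exact hz
      · intro hz
        exact Or.inr ⟨hdiff n (hN' _ (by simp)), Or.inr hz⟩

theorem conjecture_eq_of_maximal (hns : ¬ Stuck U T) {P : List (ℕ × ℕ)} (hP : Settled U T P)
    (hmax : ∀ y, ¬ Settled U T (P ++ [y])) (i : ℕ) {g : ℕ → ℕ}
    (hg : Set.range g = familySet U T i) :
    ∃ N, ∀ n ≥ N, conjecture U T (initSeg g n) = Set.range g := by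
  have hcase : Set.range g = limitSet U T ∨ Set.range g = Set.univ := by
    cases i with
    | zero => exact Or.inl hg
    | succ s => exact Or.inr (hg.trans (familySet_succ_of_not_stuck hns s))
  cases hPe : P with
  | nil =>
    have hL : limitSet U T = Set.univ := Set.eq_univ_of_forall fun z =>
      mem_limitSet_of_maximal hns hP hmax (by simp [hPe])
    have hg' : Set.range g = Set.univ := hcase.elim (fun h => h.trans hL) id
    refine ⟨0, fun n _ => ?_⟩
    rw [hg']
    exact Set.eq_univ_of_univ_subset (hL ▸ limitSet_subset_conjecture _)
  | cons a Q =>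
    have ha : a.1 ∉ limitSet U T := hP.notMem_limitSet (by simp [hPe])
    have hP' := hP
    obtain ⟨s₀, h⟩ := hP'
    have hhead : ∀ n ≥ s₀, ((run U T n).2.map Prod.fst).headI = a.1 := by
      intro n hn
      obtain ⟨l, hl⟩ := h n hn
      rw [← hl, hPe]
      rfl
    rcases hcase with hc | hc
    · refine ⟨s₀, fun n hn => ?_⟩
      rw [hc]
      refine Set.Subset.antisymm ?_ (limitSet_subset_conjecture _)
      rintro z (hz | ⟨-, hz⟩)
      · exact hz
      · rw [length_initSeg, hhead n hn] at hz
        rcases hz with hz | hz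
        · obtain ⟨k, -, hk⟩ := mem_initSeg.1 hz
          exact absurd (hc ▸ hk ▸ Set.mem_range_self k) ha
        · exact mem_limitSet_of_maximal hns hP hmax fun hz' =>
            hz (((h n hn).map Prod.fst).subset hz')
    · obtain ⟨N, hN⟩ := exists_subset_initSeg (f := g) (l := [a.1]) (by simp [hc])
      refine ⟨max N s₀, fun n hn => ?_⟩
      have hx := hN n ((le_max_left _ _).trans hn) a.1 (by simp)
      rw [hc]
      refine Set.eq_univ_of_forall fun z => Or.inr ?_
      rw [length_initSeg, hhead n ((le_max_right _ _).trans hn)]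
      exact ⟨fun hcon => ha ⟨n, hcon.1 _ hx⟩, Or.inl hx⟩

end Family

/-! ### Effectivity -/

/-- Indices of uniformly c.e. sets can be computed from the parameter. -/
theorem exists_index {α : Type*} [Primcodable α] {p : α → ℕ → ℕ → Prop}
    (hp : PrimrecPred fun a : (α × ℕ) × ℕ => p a.1.1 a.1.2 a.2) :
    ∃ g : α → ℕ, Computable g ∧ ∀ a, Wset (g a) = {x | ∃ t, p a x t} := by
  classical
  have hF : Partrec fun b : α × ℕ =>
      Nat.rfind fun t => (Part.some (decide (p b.1 b.2 t)) : Part Bool) :=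
    Partrec.rfind (p := fun (b : α × ℕ) t => (Part.some (decide (p b.1 b.2 t)) : Part Bool))
      (Computable.partrec (PrimrecPred.decide hp).to_comp)
  obtain ⟨c, hc⟩ := Nat.Partrec.Code.exists_code.1 hF
  refine ⟨fun a => Encodable.encode (c.curry (Encodable.encode a)),
    (Primrec.encode.comp (Nat.Partrec.Code.primrec₂_curry.comp (.const c) .encode)).to_comp,
    fun a => ?_⟩
  ext x
  have hd : (Encodable.decode (Nat.pair (Encodable.encode a) x) : Option (α × ℕ)) =
      some (a, x) := by
    simp [Encodable.decode_prod_val]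
  simp only [Wset, Set.mem_ofPred_eq, Denumerable.ofNat_encode, Nat.Partrec.Code.eval_curry, hc,
    hd]
  simp only [Part.coe_some, Part.bind_some, Part.map_Dom]
  exact Nat.rfind_dom.trans ⟨fun ⟨t, ht, _⟩ => ⟨t, by simpa using ht⟩,
    fun ⟨t, ht⟩ => ⟨t, by simpa using ht, fun _ => trivial⟩⟩

/-- `q` enters the `e`-th c.e. set, where `c` codes a pair with second component `e`, in fewer
than `s` steps. -/
def guardTest (c s q : ℕ) : Bool :=
  (Nat.Partrec.Code.evaln s (Denumerable.ofNat Nat.Partrec.Code c.unpair.2) q).isSome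

/-- The conjecture of the `m`-th learner on the tagged sequence `τ`, where `c` codes a pair with
first component `m`, contains the tagged number `x` after `s` steps. -/
def learnerTest (c s : ℕ) (τ : List ℕ) (x : ℕ) : Bool :=
  ((Nat.Partrec.Code.evaln s (Denumerable.ofNat Nat.Partrec.Code c.unpair.1)
    (Encodable.encode (τ.map (Nat.pair c)))).bind fun h =>
      Nat.Partrec.Code.evaln s (Denumerable.ofNat Nat.Partrec.Code h) (Nat.pair c x)).isSome

theorem guardTest_mono {c s t q : ℕ} (hst : s ≤ t) (h : guardTest c s q = true) :
    guardTest c t q = true := by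
  obtain ⟨y, hy⟩ := Option.isSome_iff_exists.1 h
  exact Option.isSome_iff_exists.2 ⟨y, Nat.Partrec.Code.evaln_mono hst hy⟩

theorem lt_of_guardTest {c s q : ℕ} (h : guardTest c s q = true) : q < s := by
  obtain ⟨y, hy⟩ := Option.isSome_iff_exists.1 h
  exact Nat.Partrec.Code.evaln_bound hy

theorem setOf_guardTest_eq_false (c : ℕ) :
    {q | ∀ s, guardTest c s q = false} = (Wset c.unpair.2)ᶜ := by
  ext q
  rw [Set.mem_compl_iff, Set.mem_ofPred_eq, ← not_iff_not, not_not]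
  push Not
  constructor
  · rintro ⟨s, hs⟩
    obtain ⟨y, hy⟩ := Option.isSome_iff_exists.1 (Bool.eq_true_of_not_eq_false hs)
    exact Part.dom_iff_mem.2 ⟨y, Nat.Partrec.Code.evaln_sound hy⟩
  · intro h
    obtain ⟨y, hy⟩ := Part.dom_iff_mem.1 h
    obtain ⟨s, hs⟩ := Nat.Partrec.Code.evaln_complete.1 hy
    exact ⟨s, Bool.ne_false_iff.2 (Option.isSome_iff_exists.2 ⟨y, hs⟩)⟩

theorem learnerTest_eq_true_iff {c s x : ℕ} {τ : List ℕ} : learnerTest c s τ x = true ↔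
    ∃ h ∈ Nat.Partrec.Code.evaln s (Denumerable.ofNat Nat.Partrec.Code c.unpair.1)
      (Encodable.encode (τ.map (Nat.pair c))),
    ∃ y, y ∈ Nat.Partrec.Code.evaln s (Denumerable.ofNat Nat.Partrec.Code h) (Nat.pair c x) := by
  rw [learnerTest, Option.isSome_iff_exists]
  constructor
  · rintro ⟨y, hy⟩
    obtain ⟨h, hh, hy⟩ := Option.bind_eq_some_iff.1 hy
    exact ⟨h, hh, y, hy⟩
  · rintro ⟨h, hh, y, hy⟩
    exact ⟨y, Option.bind_eq_some_iff.2 ⟨h, hh, hy⟩⟩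

theorem learnerTest_mono {c s t x : ℕ} {τ : List ℕ} (hst : s ≤ t)
    (h : learnerTest c s τ x = true) : learnerTest c t τ x = true := by
  rw [learnerTest_eq_true_iff] at h ⊢
  obtain ⟨h, hh, y, hy⟩ := h
  exact ⟨h, Nat.Partrec.Code.evaln_mono hst hh, y, Nat.Partrec.Code.evaln_mono hst hy⟩

theorem exists_learnerTest_iff {c x : ℕ} {τ : List ℕ} : (∃ s, learnerTest c s τ x = true) ↔
    ∃ h ∈ learnerOfCode c.unpair.1 (τ.map (Nat.pair c)), Nat.pair c x ∈ Wset h := by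
  constructor
  · rintro ⟨s, hs⟩
    obtain ⟨h, hh, y, hy⟩ := learnerTest_eq_true_iff.1 hs
    exact ⟨h, Nat.Partrec.Code.evaln_sound hh,
      Part.dom_iff_mem.2 ⟨y, Nat.Partrec.Code.evaln_sound hy⟩⟩
  · rintro ⟨h, hh, hx⟩
    obtain ⟨y, hy⟩ := Part.dom_iff_mem.1 hx
    obtain ⟨s, hs⟩ := Nat.Partrec.Code.evaln_complete.1 hh
    obtain ⟨t, ht⟩ := Nat.Partrec.Code.evaln_complete.1 hy
    exact ⟨max s t, learnerTest_eq_true_iff.2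
      ⟨h, Nat.Partrec.Code.evaln_mono (le_max_left _ _) hs, y,
        Nat.Partrec.Code.evaln_mono (le_max_right _ _) ht⟩⟩

theorem primrec_guardTest : Primrec fun a : ℕ × ℕ × ℕ => guardTest a.1 a.2.1 a.2.2 :=
  Primrec.option_isSome.comp (Nat.Partrec.Code.primrec_evaln.comp
    (((Primrec.fst.comp .snd).pair ((Primrec.ofNat _).comp
      (Primrec.snd.comp (Primrec.unpair.comp .fst)))).pair (Primrec.snd.comp .snd)))

theorem primrec_learnerTest :
    Primrec fun a : ℕ × ℕ × List ℕ × ℕ => learnerTest a.1 a.2.1 a.2.2.1 a.2.2.2 := by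
  have hs : Primrec fun a : ℕ × ℕ × List ℕ × ℕ => a.2.1 := Primrec.fst.comp .snd
  have hτ : Primrec fun a : ℕ × ℕ × List ℕ × ℕ => a.2.2.1.map (Nat.pair a.1) :=
    Primrec.list_map (Primrec.fst.comp (Primrec.snd.comp .snd))
      (Primrec₂.natPair.comp (Primrec.fst.comp .fst) .snd).to₂
  have h1 := Nat.Partrec.Code.primrec_evaln.comp ((hs.pair ((Primrec.ofNat _).comp
    (Primrec.fst.comp (Primrec.unpair.comp .fst)))).pair (Primrec.encode.comp hτ))
  refine Primrec.option_isSome.comp (Primrec.option_bind h1 ?_)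
  exact (Nat.Partrec.Code.primrec_evaln.comp (((hs.comp .fst).pair
    ((Primrec.ofNat _).comp .snd)).pair (Primrec₂.natPair.comp (Primrec.fst.comp .fst)
      (Primrec.snd.comp (Primrec.snd.comp (Primrec.snd.comp .fst)))))).to₂

/-- The diagonal construction for the pair coded by `c`. -/
abbrev diagRun (c : ℕ) : ℕ → List ℕ × List (ℕ × ℕ) := run (guardTest c) (learnerTest c)

theorem primrec_diagRun : Primrec₂ diagRun := primrec_run primrec_guardTest primrec_learnerTest

/-- The set `S` with all its elements tagged by `c`. -/
def tagged (c : ℕ) (S : Set ℕ) : Set ℕ := {y | y.unpair.1 = c ∧ y.unpair.2 ∈ S}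

theorem pair_mem_tagged {c x : ℕ} {S : Set ℕ} : Nat.pair c x ∈ tagged c S ↔ x ∈ S := by
  simp [tagged]

theorem range_pair (c : ℕ) (g : ℕ → ℕ) :
    Set.range (fun n => Nat.pair c (g n)) = tagged c (Set.range g) := by
  ext y
  constructor
  · rintro ⟨n, rfl⟩
    exact pair_mem_tagged.2 (Set.mem_range_self n)
  · rintro ⟨rfl, n, hn⟩
    exact ⟨n, by simp [hn]⟩

theorem exists_untagged {c : ℕ} {S : Set ℕ} {f : ℕ → ℕ} (hf : Set.range f = tagged c S) :
    ∃ g : ℕ → ℕ, f = (fun n => Nat.pair c (g n)) ∧ Set.range g = S := by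
  have h1 : ∀ n, (f n).unpair.1 = c := fun n =>
    ((hf ▸ Set.mem_range_self n : f n ∈ tagged c S)).1
  have hfg : f = fun n => Nat.pair c (f n).unpair.2 := by
    ext n
    rw [← h1 n, Nat.pair_unpair]
  refine ⟨fun n => (f n).unpair.2, hfg, ?_⟩
  rw [hfg, range_pair] at hf
  ext x
  rw [← pair_mem_tagged (c := c), hf, pair_mem_tagged]

theorem initSeg_pair (c : ℕ) (g : ℕ → ℕ) (n : ℕ) :
    initSeg (fun n => Nat.pair c (g n)) n = (initSeg g n).map (Nat.pair c) := by
  simp [initSeg]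

/-- Stage `t` confirms that `y` is in the `i`-th member of the tagged family. -/
def FamilyStage (c i y t : ℕ) : Prop :=
  y.unpair.1 = c ∧ ((i = 0 ∧ y.unpair.2 ∈ (diagRun c t).1) ∨
    (i ≠ 0 ∧ (y.unpair.2 ∉ (diagRun c (i - 1)).2.map Prod.fst ∨
      (i - 1 ≤ t ∧ diagRun c t ≠ diagRun c (i - 1)))))

theorem exists_familyStage (c i : ℕ) :
    {y | ∃ t, FamilyStage c i y t} = tagged c (familySet (guardTest c) (learnerTest c) i) := by
  ext y
  cases i with
  | zero => simp [FamilyStage, tagged, familySet, limitSet]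
  | succ s =>
    constructor
    · rintro ⟨t, h1, h2⟩
      refine ⟨h1, ?_⟩
      rcases h2 with ⟨h2, -⟩ | ⟨-, h2 | ⟨h2, h3⟩⟩
      · exact absurd h2 (Nat.succ_ne_zero s)
      · exact Or.inl h2
      · exact Or.inr ⟨t, h2, h3⟩
    · rintro ⟨h1, h2 | ⟨t, h2, h3⟩⟩
      · exact ⟨0, h1, Or.inr ⟨Nat.succ_ne_zero s, Or.inl h2⟩⟩
      · exact ⟨t, h1, Or.inr ⟨Nat.succ_ne_zero s, Or.inr ⟨h2, h3⟩⟩⟩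

theorem primrecPred_familyStage :
    PrimrecPred fun a : ((ℕ × ℕ) × ℕ) × ℕ => FamilyStage a.1.1.1 a.1.1.2 a.1.2 a.2 := by
  have hc : Primrec fun a : ((ℕ × ℕ) × ℕ) × ℕ => a.1.1.1 :=
    Primrec.fst.comp (Primrec.fst.comp .fst)
  have hi : Primrec fun a : ((ℕ × ℕ) × ℕ) × ℕ => a.1.1.2 :=
    Primrec.snd.comp (Primrec.fst.comp .fst)
  have hy : Primrec fun a : ((ℕ × ℕ) × ℕ) × ℕ => a.1.2.unpair :=
    Primrec.unpair.comp (Primrec.snd.comp .fst)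
  have hi1 := Primrec.pred.comp hi
  have ht := primrec_diagRun.comp hc .snd
  have hs := primrec_diagRun.comp hc hi1
  have hz : PrimrecPred fun a : ((ℕ × ℕ) × ℕ) × ℕ => a.1.1.2 = 0 :=
    Primrec.eq.comp hi (.const 0)
  exact (Primrec.eq.comp (Primrec.fst.comp hy) hc).and
    ((hz.and (primrecRel_mem.comp (Primrec.fst.comp ht) (Primrec.snd.comp hy))).or
      (hz.not.and ((primrecRel_notMem.comp (Primrec.snd.comp hy)
        (primrec_restrained.comp (Primrec.snd.comp hs))).or
        ((Primrec.nat_le.comp hi1 .snd).and (Primrec.eq.comp ht hs).not))))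

/-- Stage `t` confirms that `y` is in the tagged conjecture on `l`. -/
def ConjectureStage (c : ℕ) (l : List ℕ) (y t : ℕ) : Prop :=
  y.unpair.1 = c ∧ (y.unpair.2 ∈ (diagRun c t).1 ∨
    ¬ ((∀ x ∈ l, x ∈ (diagRun c l.length).1) ∧ ∀ x ∈ (diagRun c l.length).1, x ∈ l) ∧
    (((diagRun c l.length).2.map Prod.fst).headI ∈ l ∨
      y.unpair.2 ∉ (diagRun c l.length).2.map Prod.fst))

theorem exists_conjectureStage (c : ℕ) (l : List ℕ) :
    {y | ∃ t, ConjectureStage c l y t} =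
      tagged c (conjecture (guardTest c) (learnerTest c) l) := by
  ext y
  constructor
  · rintro ⟨t, h1, h2⟩
    exact ⟨h1, h2.imp_left fun h => ⟨t, h⟩⟩
  · rintro ⟨h1, ⟨t, h2⟩ | h2⟩
    · exact ⟨t, h1, Or.inl h2⟩
    · exact ⟨0, h1, Or.inr h2⟩

theorem primrecPred_conjectureStage :
    PrimrecPred fun a : ((ℕ × List ℕ) × ℕ) × ℕ =>
      ConjectureStage a.1.1.1 a.1.1.2 a.1.2 a.2 := by
  have hc : Primrec fun a : ((ℕ × List ℕ) × ℕ) × ℕ => a.1.1.1 :=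
    Primrec.fst.comp (Primrec.fst.comp .fst)
  have hl : Primrec fun a : ((ℕ × List ℕ) × ℕ) × ℕ => a.1.1.2 :=
    Primrec.snd.comp (Primrec.fst.comp .fst)
  have hy : Primrec fun a : ((ℕ × List ℕ) × ℕ) × ℕ => a.1.2.unpair :=
    Primrec.unpair.comp (Primrec.snd.comp .fst)
  have ht := primrec_diagRun.comp hc .snd
  have hs := primrec_diagRun.comp hc (Primrec.list_length.comp hl)
  have hX := primrec_restrained.comp (Primrec.snd.comp hs)
  have hsub : PrimrecRel fun l l' : List ℕ => ∀ x ∈ l, x ∈ l' :=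
    (PrimrecRel.forall_mem_list (R := fun (x : ℕ) (l : List ℕ) => x ∈ l) primrecRel_mem.swap)
  exact (Primrec.eq.comp (Primrec.fst.comp hy) hc).and
    ((primrecRel_mem.comp (Primrec.fst.comp ht) (Primrec.snd.comp hy)).or
      (((hsub.comp hl (Primrec.fst.comp hs)).and (hsub.comp (Primrec.fst.comp hs) hl)).not.and
        ((primrecRel_mem.comp hl (Primrec.list_headI.comp hX)).or
          (primrecRel_notMem.comp (Primrec.snd.comp hy) hX))))

/-! ### Diagonalization -/

section Diagonal

variable {c : ℕ}

theorem diag_of_not_stuck (hinf : (Wset c.unpair.2)ᶜ.Infinite)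
    (hns : ¬ Stuck (guardTest c) (learnerTest c)) :
    ¬ TxtBCLearnsSet (learnerOfCode c.unpair.1)
      (tagged c (familySet (guardTest c) (learnerTest c) 0)) := by
  intro hlearn
  rw [← setOf_guardTest_eq_false] at hinf
  obtain ⟨g, hg, hseg⟩ := exists_limit_text hns
  obtain ⟨N, hN⟩ := hlearn (fun n => Nat.pair c (g n)) (by rw [range_pair, hg]; rfl)
  obtain ⟨s, τ, x, hn, hτ, hx, ht⟩ := exists_test_of_settled hns
    (exists_settled_length (fun _ _ _ => guardTest_mono) (fun _ _ => lt_of_guardTest) hns hinf) N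
  obtain ⟨h, hh, hW⟩ := exists_learnerTest_iff.1 ht
  obtain ⟨h', hh', hW'⟩ := hN _ hn
  rw [initSeg_pair, hseg s τ hτ] at hh'
  rw [hh', Part.mem_some_iff] at hh
  rw [hh, hW', range_pair, pair_mem_tagged, hg] at hW
  exact hx hW

theorem diag_of_stuck {s₀ : ℕ} (h : ∀ s ≥ s₀, diagRun c s = diagRun c s₀) :
    ¬ TxtBCLearnsSet (learnerOfCode c.unpair.1)
      (tagged c (familySet (guardTest c) (learnerTest c) (s₀ + 1))) := by
  intro hlearn
  set X := (diagRun c s₀).2.map Prod.fst with hX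
  have hfam : familySet (guardTest c) (learnerTest c) (s₀ + 1) = {z | z ∉ X} := by
    ext z
    exact or_iff_left fun ⟨t, ht, ht'⟩ => ht' (h t ht)
  obtain ⟨g, hg, hseg⟩ := exists_compl_text (zero_mem_run s₀)
    (X := X) fun z hz hz' => run_disjoint s₀ z hz' hz
  obtain ⟨N, hN⟩ := hlearn (fun n => Nat.pair c (g n)) (by rw [range_pair, hg, hfam])
  obtain ⟨ρ, hρ, he⟩ := hseg _ (le_max_right N (diagRun c s₀).1.length)
  obtain ⟨h', hh', hW'⟩ := hN _ (le_max_left N (diagRun c s₀).1.length)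
  obtain ⟨x, hx⟩ := Infinite.exists_notMem_finset (((diagRun c s₀).1 ++ ρ) ++ X).toFinset
  rw [List.mem_toFinset, List.mem_append, not_or] at hx
  obtain ⟨t, ht⟩ : ∃ t, learnerTest c t ((diagRun c s₀).1 ++ ρ) x = true := by
    refine exists_learnerTest_iff.2 ⟨h', ?_, ?_⟩
    · rw [← he, ← initSeg_pair, hh']
      exact Part.mem_some _
    · rw [hW', range_pair, pair_mem_tagged, hg]
      exact hx.2
  have := Stuck.test_eq_false (U := guardTest c) (T := learnerTest c)
    (fun _ _ _ _ => learnerTest_mono) h hρ hx.1 hx.2 t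
  rw [this] at ht
  cases ht

/-- A family with just the two members `limitSet` and `ℕ` is learnable. -/
theorem exists_learner_of_not_stuck (hinf : (Wset c.unpair.2)ᶜ.Infinite)
    (hns : ¬ Stuck (guardTest c) (learnerTest c)) :
    ∃ M : List ℕ →. ℕ, Partrec M ∧
      ∀ i, TxtBCLearnsSet M (tagged c (familySet (guardTest c) (learnerTest c) i)) := by
  classical
  rw [← setOf_guardTest_eq_false] at hinf
  obtain ⟨k, -, hk⟩ := exists_index (p := fun a : ℕ × ℕ => FamilyStage a.1 a.2)
    primrecPred_familyStage
  obtain ⟨y, hy⟩ := Settled.exists_extend (U := guardTest c) (T := learnerTest c)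
    (fun _ _ _ => guardTest_mono) (fun _ _ => lt_of_guardTest) hns hinf settled_nil
  have hyL : y.1 ∉ limitSet (guardTest c) (learnerTest c) := hy.notMem_limitSet (by simp)
  refine ⟨fun σ => Part.some (if Nat.pair c y.1 ∈ σ then k (c, 1) else k (c, 0)),
    (Primrec.ite (primrecRel_mem.comp .id (.const _)) (.const _) (.const _)).to_comp,
    fun i f hf => ?_⟩
  cases i with
  | zero =>
    refine ⟨0, fun n _ => ⟨k (c, 0), ?_, ?_⟩⟩
    · refine congrArg Part.some (if_neg fun hmem => ?_)
      obtain ⟨j, -, hj⟩ := mem_initSeg.1 hmem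
      have := hf ▸ Set.mem_range_self j
      rw [hj, pair_mem_tagged] at this
      exact hyL this
    · rw [hk, exists_familyStage, hf]
  | succ s =>
    rw [familySet_succ_of_not_stuck hns] at hf
    have hmem : Nat.pair c y.1 ∈ Set.range f := by
      rw [hf, pair_mem_tagged]
      trivial
    obtain ⟨N, hN⟩ := exists_subset_initSeg (f := f) (l := [Nat.pair c y.1]) (by simpa using hmem)
    refine ⟨N, fun n hn => ⟨k (c, 1), ?_, ?_⟩⟩
    · exact congrArg Part.some (if_pos (hN n hn _ (by simp)))
    · rw [hk, exists_familyStage, familySet_succ_of_not_stuck hns, hf]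

end Diagonal

/-- A single learner learns the families of all constructions that are stuck or belong to
a cofinite set. -/
theorem exists_uniform_learner : ∃ N : List ℕ →. ℕ, Partrec N ∧
    ∀ c, (Stuck (guardTest c) (learnerTest c) ∨ (Wset c.unpair.2)ᶜ.Finite) →
      ∀ i, TxtBCLearnsSet N (tagged c (familySet (guardTest c) (learnerTest c) i)) := by
  obtain ⟨k, hkc, hk⟩ := exists_index (p := fun a : ℕ × List ℕ => ConjectureStage a.1 a.2)
    primrecPred_conjectureStage
  refine ⟨fun σ => Part.some (k (σ.headI.unpair.1, σ.map fun y => y.unpair.2)), ?_, ?_⟩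
  · exact hkc.comp ((Primrec.fst.comp (Primrec.unpair.comp Primrec.list_headI)).pair
      (Primrec.list_map .id (Primrec.snd.comp (Primrec.unpair.comp .snd)).to₂)).to_comp
  · intro c hc i f hf
    obtain ⟨g, rfl, hg⟩ := exists_untagged hf
    obtain ⟨N, hN⟩ : ∃ N, ∀ n ≥ N,
        conjecture (guardTest c) (learnerTest c) (initSeg g n) = Set.range g := by
      by_cases hs : Stuck (guardTest c) (learnerTest c)
      · exact conjecture_eq_of_stuck hs i hg
      · have hfin := hc.resolve_left hs
        rw [← setOf_guardTest_eq_false] at hfin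
        obtain ⟨P, hP, hmax⟩ := exists_maximal_settled (U := guardTest c)
          (T := learnerTest c) (fun _ _ _ => guardTest_mono) (fun _ _ => lt_of_guardTest) hfin
        exact conjecture_eq_of_maximal hs hP hmax i hg
    refine ⟨max N 1, fun n hn => ⟨_, rfl, ?_⟩⟩
    have h1 : (initSeg (fun n => Nat.pair c (g n)) n).headI.unpair.1 = c := by
      obtain ⟨j, rfl⟩ := Nat.exists_eq_add_of_le ((le_max_right N 1).trans hn)
      rw [add_comm, initSeg, List.range_succ_eq_map]
      simp
    have h2 : (initSeg (fun n => Nat.pair c (g n)) n).map (fun y => y.unpair.2) =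
        initSeg g n := by
      simp [initSeg]
    rw [h1, h2, hk, exists_conjectureStage, hN n ((le_max_left _ _).trans hn), range_pair]

/-- There is a computable `h` such that `h m e` codes a u.c.e. family which,
when `W_e` is coinfinite, is TxtBC-learnable but not by the `m`-th learner, and
a single computable learner `N` TxtBC-learns all the families `h m e`
with `W_e` cofinite. -/
theorem txtBC_diagonal_family :
    ∃ h : ℕ → ℕ → ℕ, Computable₂ h ∧
      (∀ m e : ℕ, (Wset e)ᶜ.Infinite →
        (∃ M : List ℕ →. ℕ, Partrec M ∧ ∀ i, TxtBCLearnsSet M (column (h m e) i)) ∧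
        ¬ (∀ i, TxtBCLearnsSet (learnerOfCode m) (column (h m e) i))) ∧
      (∃ N : List ℕ →. ℕ, Partrec N ∧
        ∀ m e : ℕ, (Wset e)ᶜ.Finite →
          ∀ i, TxtBCLearnsSet N (column (h m e) i)) := by
  obtain ⟨k, hkc, hk⟩ := exists_index
    (p := fun (a : ℕ × ℕ) x t => FamilyStage (Nat.pair a.1 a.2) x.unpair.1 x.unpair.2 t) (by
      have hx : Primrec fun a : ((ℕ × ℕ) × ℕ) × ℕ => a.1.2.unpair :=
        Primrec.unpair.comp (Primrec.snd.comp .fst)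
      have hc : Primrec fun a : ((ℕ × ℕ) × ℕ) × ℕ => Nat.pair a.1.1.1 a.1.1.2 :=
        Primrec₂.natPair.comp (Primrec.fst.comp (Primrec.fst.comp .fst))
          (Primrec.snd.comp (Primrec.fst.comp .fst))
      exact primrecPred_familyStage.comp
        (((hc.pair (Primrec.fst.comp hx)).pair (Primrec.snd.comp hx)).pair .snd))
  have hcol : ∀ m e i, column (k (m, e)) i = tagged (Nat.pair m e)
      (familySet (guardTest (Nat.pair m e)) (learnerTest (Nat.pair m e)) i) := by
    intro m e i
    rw [← exists_familyStage]
    ext y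
    simp [column, hk]
  obtain ⟨N, hNc, hN⟩ := exists_uniform_learner
  refine ⟨fun m e => k (m, e), hkc, fun m e hinf => ?_, N, hNc, fun m e hfin i => ?_⟩
  · simp only [hcol]
    have hinf' : (Wset (Nat.pair m e).unpair.2)ᶜ.Infinite := by simpa using hinf
    by_cases hs : Stuck (guardTest (Nat.pair m e)) (learnerTest (Nat.pair m e))
    · refine ⟨⟨N, hNc, hN _ (Or.inl hs)⟩, fun hall => ?_⟩
      obtain ⟨s₀, h⟩ := hs
      exact diag_of_stuck h (by simpa using hall (s₀ + 1))
    · exact ⟨exists_learner_of_not_stuck hinf' hs,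
        fun hall => diag_of_not_stuck hinf' hs (by simpa using hall 0)⟩
  · rw [hcol]
    exact hN _ (Or.inr (by simpa using hfin)) i
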